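/- Let A : ℝ^{nN} → ℝ^{nN} satisfy the (p,q)-ellipticity and growth conditions and the skew-symmetry control, and assume moreover that q < p + 2 and p < n. Then for every open set Ω′ whose closure is compact and contained in Ω, and for all L, B > 0, there exists a constant C > 0, depending only on Ω′, n, N, p, q, m, M, L and B, such that every twice continuously differentiable weak solution u : Ω → ℝ^N of div A(Du) = 0 in Ω satisfying ∫_Ω |Du|^p dx ≤ L and sup_{x∈Ω} |u(x)| ≤ B also satisfies ∫_{Ω′} ( |V(Du)|^{2q/p} + |D(V(Du))|² + (1+|Du|²)^{(p−2)/2}|D²u|² ) dx ≤ C. -/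

import Mathlib

open MeasureTheory Real

noncomputable section

abbrev Vec (n N : ℕ) := EuclideanSpace ℝ (Fin n × Fin N)

abbrev Pt (n : ℕ) := EuclideanSpace ℝ (Fin n)

def dA {n N : ℕ} (A : Vec n N → Vec n N) (ξ : Vec n N)
    (i : Fin n) (α : Fin N) (j : Fin n) (β : Fin N) : ℝ :=
  fderiv ℝ A ξ (EuclideanSpace.single (j, β) 1) (i, α)

structure EllipticGrowth (n N : ℕ) (p q m M : ℝ) (A : Vec n N → Vec n N) : Prop where
  differentiable : Differentiable ℝ A
  ellipticity : ∀ ξ lam : Vec n N,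
    m * (1 + ‖ξ‖ ^ 2) ^ ((p - 2) / 2) * ‖lam‖ ^ 2 ≤
      ∑ i : Fin n, ∑ j : Fin n, ∑ α : Fin N, ∑ β : Fin N,
        dA A ξ i α j β * lam (i, α) * lam (j, β)
  growth : ∀ (ξ : Vec n N) (i : Fin n) (α : Fin N) (j : Fin n) (β : Fin N),
    |dA A ξ i α j β| ≤ M * (1 + ‖ξ‖ ^ 2) ^ ((q - 2) / 2)

def SkewControl (n N : ℕ) (p q M : ℝ) (A : Vec n N → Vec n N) : Prop :=
  ∀ (ξ : Vec n N) (i : Fin n) (α : Fin N) (j : Fin n) (β : Fin N),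
    |dA A ξ i α j β - dA A ξ j β i α| ≤ M * (1 + ‖ξ‖ ^ 2) ^ ((q + p - 4) / 4)

def grad {n N : ℕ} (u : Pt n → EuclideanSpace ℝ (Fin N)) (x : Pt n) : Vec n N :=
  (WithLp.equiv 2 ((Fin n × Fin N) → ℝ)).symm
    fun iα => fderiv ℝ u x (EuclideanSpace.single iα.1 1) iα.2

def hessSq {n N : ℕ} (u : Pt n → EuclideanSpace ℝ (Fin N)) (x : Pt n) : ℝ :=
  ∑ i : Fin n, ∑ k : Fin n, ∑ α : Fin N,
    (fderiv ℝ (fun y => fderiv ℝ u y (EuclideanSpace.single i 1) α) x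
      (EuclideanSpace.single k 1)) ^ 2

def IsWeakSolution {n N : ℕ} (A : Vec n N → Vec n N) (Ω : Set (Pt n))
    (u : Pt n → EuclideanSpace ℝ (Fin N)) : Prop :=
  ∀ φ : Pt n → EuclideanSpace ℝ (Fin N),
    ContDiff ℝ (⊤ : ℕ∞) φ → HasCompactSupport φ → tsupport φ ⊆ Ω →
    ∫ x in Ω, ∑ i : Fin n, ∑ α : Fin N,
      A (grad u x) (i, α) * fderiv ℝ φ x (EuclideanSpace.single i 1) α = 0

def Vmap {n N : ℕ} (p : ℝ) (ξ : Vec n N) : Vec n N := ((1 + ‖ξ‖ ^ 2) ^ ((p - 2) / 4)) • ξ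

def gradVSq {n N : ℕ} (p : ℝ) (u : Pt n → EuclideanSpace ℝ (Fin N)) (x : Pt n) : ℝ :=
  ∑ k : Fin n, ‖fderiv ℝ (fun y => Vmap p (grad u y)) x (EuclideanSpace.single k 1)‖ ^ 2

def Aeps {n N : ℕ} (q ε : ℝ) (A : Vec n N → Vec n N) (ξ : Vec n N) : Vec n N :=
  A ξ + (ε * (1 + ‖ξ‖ ^ 2) ^ ((max q 2 - 2) / 2)) • ξ

open scoped ContDiff Topology Manifold Pointwise

/-- A smooth cutoff between a compact set and an open neighbourhood of it. -/
lemma exists_smooth_cutoff {n : ℕ} {K U : Set (Pt n)} (hK : IsCompact K) (hU : IsOpen U)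
    (hKU : K ⊆ U) :
    ∃ η : Pt n → ℝ, ContDiff ℝ ∞ η ∧ HasCompactSupport η ∧ tsupport η ⊆ U ∧
      (∀ᶠ x in 𝓝ˢ K, η x = 1) ∧ ∀ x, η x ∈ Set.Icc (0 : ℝ) 1 := by
  obtain ⟨K', hK', hKK', hK'U⟩ := exists_compact_between hK hU hKU
  obtain ⟨f, hf1, hf0, hf⟩ := exists_contMDiffMap_one_nhds_of_subset_interior (n := (⊤ : ℕ∞))
    (𝓘(ℝ, Pt n)) hK.isClosed hKK'
  have hts : tsupport f ⊆ K' :=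
    closure_minimal (fun x hx => by_contra fun h => hx (hf0 x h)) hK'.isClosed
  exact ⟨f, f.contMDiff.contDiff, hK'.of_isClosed_subset (isClosed_tsupport _) hts,
    hts.trans hK'U, hf1, hf⟩

/-- A compactly supported `C¹` function can be approximated in `C¹` by smooth functions
supported in a small neighbourhood of its support. -/
lemma exists_smooth_fderiv_approx {n : ℕ} {g : Pt n → ℝ} (hg : ContDiff ℝ 1 g)
    (hgc : HasCompactSupport g) {δ ε : ℝ} (hδ : 0 < δ) (hε : 0 < ε) :
    ∃ f : Pt n → ℝ, ContDiff ℝ ∞ f ∧ tsupport f ⊆ Metric.cthickening δ (tsupport g) ∧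
      ∀ x, ‖fderiv ℝ f x - fderiv ℝ g x‖ ≤ ε := by
  have hcont : Continuous (fderiv ℝ g) := hg.continuous_fderiv one_ne_zero
  have hunif : UniformContinuous (fderiv ℝ g) :=
    (hgc.fderiv ℝ).uniformContinuous_of_continuous hcont
  obtain ⟨r, hr, hrε⟩ := Metric.uniformContinuous_iff.1 hunif ε hε
  have hs : 0 < min r δ := lt_min hr hδ
  let φ : ContDiffBump (0 : Pt n) := ⟨min r δ / 2, min r δ, half_pos hs, half_lt_self hs⟩
  have hφ : LocallyIntegrable (φ.normed volume) (volume : Measure (Pt n)) :=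
    φ.continuous_normed.locallyIntegrable
  refine ⟨MeasureTheory.convolution (φ.normed volume) g (ContinuousLinearMap.lsmul ℝ ℝ) volume,
    ?_, ?_, fun x => ?_⟩
  · exact φ.hasCompactSupport_normed.contDiff_convolution_left _ φ.contDiff_normed
      hg.continuous.locallyIntegrable
  · refine closure_minimal ?_ Metric.isClosed_cthickening
    refine (MeasureTheory.support_convolution_subset _).trans ?_
    rw [φ.support_normed_eq, add_comm, add_ball_zero]
    exact (Metric.thickening_mono (min_le_right _ _) _).trans
      ((Metric.thickening_subset_of_subset _ (subset_tsupport g)).trans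
        (Metric.thickening_subset_cthickening _ _))
  · have h := (hgc.hasFDerivAt_convolution_right (ContinuousLinearMap.lsmul ℝ ℝ) hφ hg x).fderiv
    rw [h, ← dist_eq_norm]
    refine φ.dist_normed_convolution_le (μ := volume) (g := fderiv ℝ g)
      hcont.aestronglyMeasurable fun y hy => ?_
    exact (hrε ((Metric.mem_ball.1 hy).trans_le (min_le_left _ _))).le

/-- Test functions in a first order weak equation may be taken to be merely `C¹`. -/
lemma integral_sum_mul_fderiv_eq_zero {n : ℕ} {U : Set (Pt n)} (hU : IsOpen U)
    {F : Fin n → Pt n → ℝ} (hF : ∀ i, LocallyIntegrable (F i))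
    (h : ∀ g : Pt n → ℝ, ContDiff ℝ ∞ g → HasCompactSupport g → tsupport g ⊆ U →
      ∫ x, ∑ i, F i x * fderiv ℝ g x (EuclideanSpace.single i 1) = 0)
    {g : Pt n → ℝ} (hg : ContDiff ℝ 1 g) (hgc : HasCompactSupport g) (hgU : tsupport g ⊆ U) :
    ∫ x, ∑ i, F i x * fderiv ℝ g x (EuclideanSpace.single i 1) = 0 := by
  obtain ⟨δ, hδ, hδU⟩ := hgc.isCompact.exists_cthickening_subset_open hU hgU
  set K := Metric.cthickening δ (tsupport g)
  have hK : IsCompact K := hgc.isCompact.cthickening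
  have hgK : tsupport g ⊆ K := Metric.self_subset_cthickening _
  have hint : ∀ f : Pt n → ℝ, ContDiff ℝ 1 f → HasCompactSupport f → 
      Integrable fun x => ∑ i, F i x * fderiv ℝ f x (EuclideanSpace.single i 1) := by
    intro f hf hfc
    refine integrable_finsetSum _ fun i _ => ?_
    simpa [mul_comm] using (hF i).integrable_smul_left_of_hasCompactSupport
      (g := fun x => fderiv ℝ f x (EuclideanSpace.single i 1))
      ((hf.continuous_fderiv one_ne_zero).clm_apply continuous_const)
      (hfc.fderiv_apply ℝ _)
  have hG : IntegrableOn (fun x => ∑ i, ‖F i x‖) K :=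
    integrable_finsetSum _ fun i _ => ((hF i).integrableOn_isCompact hK).norm
  set I := ∫ x in K, ∑ i, ‖F i x‖
  have key : ∀ ε > 0,
      ‖∫ x, ∑ i, F i x * fderiv ℝ g x (EuclideanSpace.single i 1)‖ ≤ ε * I := by
    intro ε hε
    obtain ⟨f, hf, hfK, hfε⟩ := exists_smooth_fderiv_approx hg hgc hδ hε
    have hfc : HasCompactSupport f := hK.of_isClosed_subset (isClosed_tsupport _) hfK
    have hf1 : ContDiff ℝ 1 f := hf.of_le (by exact_mod_cast le_top)
    have h0 := h f hf hfc (hfK.trans hδU)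
    rw [← sub_zero (∫ x, ∑ i, F i x * fderiv ℝ g x _), ← h0,
      ← integral_sub (hint g hg hgc) (hint f hf1 hfc),
      ← setIntegral_eq_integral_of_forall_compl_eq_zero (s := K),
      ← integral_const_mul]
    · refine norm_integral_le_of_norm_le (hG.const_mul ε) (Filter.Eventually.of_forall fun x => ?_)
      rw [← Finset.sum_sub_distrib, Finset.mul_sum]
      refine (norm_sum_le _ _).trans (Finset.sum_le_sum fun i _ => ?_)
      rw [← mul_sub, norm_mul, mul_comm]
      refine mul_le_mul_of_nonneg_right ?_ (norm_nonneg _)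
      rw [← sub_apply]
      refine (ContinuousLinearMap.le_opNorm _ _).trans ?_
      rw [norm_sub_rev]
      simpa using hfε x
    · intro x hx
      have h1 : fderiv ℝ g x = 0 := by
        by_contra hne
        exact hx (hgK (support_fderiv_subset ℝ hne))
      have h2 : fderiv ℝ f x = 0 := by
        by_contra hne
        exact hx (hfK (support_fderiv_subset ℝ hne))
      simp [h1, h2]
  have hI : 0 ≤ I := integral_nonneg fun x => Finset.sum_nonneg fun i _ => norm_nonneg _
  rw [← norm_le_zero_iff]
  refine le_of_forall_pos_le_add fun ε hε => ?_
  refine (key (ε / (I + 1)) (by positivity)).trans ?_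
  rw [zero_add, div_mul_eq_mul_div, div_le_iff₀ (by positivity)]
  nlinarith

lemma grad_apply {n N : ℕ} (u : Pt n → EuclideanSpace ℝ (Fin N)) (x : Pt n) (i : Fin n)
    (α : Fin N) : grad u x (i, α) = fderiv ℝ u x (EuclideanSpace.single i 1) α := rfl

section Calculus

variable {n N : ℕ} {u : Pt n → EuclideanSpace ℝ (Fin N)}

lemma contDiff_grad (hu : ContDiff ℝ 2 u) : ContDiff ℝ 1 (grad u) := by
  refine contDiff_euclidean.2 fun a => ?_
  have h : ContDiff ℝ 1 fun x => fderiv ℝ u x (EuclideanSpace.single a.1 1) :=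
    (hu.fderiv_right (m := 1) (by norm_num)).clm_apply contDiff_const
  exact contDiff_euclidean.1 h a.2

lemma continuous_hess (hu : ContDiff ℝ 2 u) (s : Fin n) :
    Continuous fun x => fderiv ℝ (grad u) x (EuclideanSpace.single s 1) :=
  ((contDiff_grad hu).continuous_fderiv one_ne_zero).clm_apply continuous_const

lemma fderiv_euclidean_apply {E ι : Type*} [NormedAddCommGroup E] [NormedSpace ℝ E] [Fintype ι]
    {f : E → EuclideanSpace ℝ ι} {x : E} (hf : DifferentiableAt ℝ f x) (a : ι) (y : E) :
    fderiv ℝ (fun z => f z a) x y = fderiv ℝ f x y a := by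
  have h := ((EuclideanSpace.proj a : EuclideanSpace ℝ ι →L[ℝ] ℝ).hasFDerivAt.comp x
    hf.hasFDerivAt).fderiv
  exact congrArg (fun T : E →L[ℝ] ℝ => T y) h

lemma fderiv_grad_apply (hu : ContDiff ℝ 2 u) (x y : Pt n) (i : Fin n) (α : Fin N) :
    fderiv ℝ (grad u) x y (i, α) =
      fderiv ℝ (fderiv ℝ u) x y (EuclideanSpace.single i 1) α := by
  have h2 : Differentiable ℝ (fderiv ℝ u) :=
    (hu.fderiv_right (m := 1) (by norm_num)).differentiable one_ne_zero
  rw [← fderiv_euclidean_apply ((contDiff_grad hu).differentiable one_ne_zero x) (i, α) y]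
  simp only [grad_apply]
  rw [fderiv_euclidean_apply ((h2 x).clm_apply (differentiableAt_const _)),
    fderiv_clm_apply (h2 x) (differentiableAt_const _)]
  simp

lemma fderiv_grad_symm (hu : ContDiff ℝ 2 u) (x : Pt n) (s i : Fin n) (α : Fin N) :
    fderiv ℝ (grad u) x (EuclideanSpace.single s 1) (i, α) =
      fderiv ℝ (grad u) x (EuclideanSpace.single i 1) (s, α) := by
  rw [fderiv_grad_apply hu, fderiv_grad_apply hu]
  have h : IsSymmSndFDerivAt ℝ u x :=
    hu.contDiffAt.isSymmSndFDerivAt (by simp)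
  rw [h.eq]

lemma hessSq_eq (hu : ContDiff ℝ 2 u) (x : Pt n) :
    hessSq u x = ∑ s, ‖fderiv ℝ (grad u) x (EuclideanSpace.single s 1)‖ ^ 2 := by
  have h1 : ∀ i k α, fderiv ℝ (fun y => fderiv ℝ u y (EuclideanSpace.single i 1) α) x
      (EuclideanSpace.single k 1) =
      fderiv ℝ (grad u) x (EuclideanSpace.single k 1) (i, α) := fun i k α =>
    fderiv_euclidean_apply ((contDiff_grad hu).differentiable one_ne_zero x) (i, α) _
  simp only [hessSq, h1, EuclideanSpace.norm_sq_eq, Fintype.sum_prod_type, Real.norm_eq_abs,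
    sq_abs]
  exact Finset.sum_comm

lemma continuous_hessSq (hu : ContDiff ℝ 2 u) : Continuous (hessSq u) := by
  have : hessSq u = fun x => ∑ s, ‖fderiv ℝ (grad u) x (EuclideanSpace.single s 1)‖ ^ 2 :=
    funext (hessSq_eq hu)
  rw [this]
  exact continuous_finsetSum _ fun s _ => (continuous_hess hu s).norm.pow 2

lemma hessSq_nonneg (u : Pt n → EuclideanSpace ℝ (Fin N)) (x : Pt n) : 0 ≤ hessSq u x :=
  Finset.sum_nonneg fun _ _ => Finset.sum_nonneg fun _ _ => Finset.sum_nonneg fun _ _ =>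
    sq_nonneg _

lemma norm_hess_le_sqrt (hu : ContDiff ℝ 2 u) (x : Pt n) (s : Fin n) :
    ‖fderiv ℝ (grad u) x (EuclideanSpace.single s 1)‖ ≤ √(hessSq u x) := by
  refine Real.le_sqrt_of_sq_le ?_
  rw [hessSq_eq hu]
  exact Finset.single_le_sum
    (f := fun s => ‖fderiv ℝ (grad u) x (EuclideanSpace.single s 1)‖ ^ 2)
    (fun _ _ => sq_nonneg _) (Finset.mem_univ s)

end Calculus

lemma abs_bilinear_sum_le {ι : Type*} [Fintype ι] {k : ℝ} {K : ι → ι → ℝ}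
    (hK : ∀ a b, |K a b| ≤ k) (x y : EuclideanSpace ℝ ι) :
    |∑ a, ∑ b, K a b * x a * y b| ≤ k * (Fintype.card ι : ℝ) ^ 2 * (‖x‖ * ‖y‖) := by
  have h : ∀ a b, |K a b * x a * y b| ≤ k * (‖x‖ * ‖y‖) := fun a b => by
    rw [abs_mul, abs_mul, mul_assoc]
    have hx := PiLp.norm_apply_le x a
    have hy := PiLp.norm_apply_le y b
    rw [Real.norm_eq_abs] at hx hy
    exact mul_le_mul (hK a b) (mul_le_mul hx hy (abs_nonneg _) (norm_nonneg _)) (by positivity)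
      ((abs_nonneg _).trans (hK a b))
  calc |∑ a, ∑ b, K a b * x a * y b| ≤ ∑ a : ι, ∑ b : ι, k * (‖x‖ * ‖y‖) :=
        (Finset.abs_sum_le_sum_abs _ _).trans (Finset.sum_le_sum fun a _ =>
          (Finset.abs_sum_le_sum_abs _ _).trans (Finset.sum_le_sum fun b _ => h a b))
    _ = _ := by simp; ring

section Structure

variable {n N : ℕ} {p q m M : ℝ} {A : Vec n N → Vec n N}

lemma inner_fderiv_eq (A : Vec n N → Vec n N) (ξ x y : Vec n N) :
    inner ℝ x (fderiv ℝ A ξ y) =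
      ∑ a : Fin n × Fin N, ∑ b : Fin n × Fin N, dA A ξ a.1 a.2 b.1 b.2 * x a * y b := by
  have hy : fderiv ℝ A ξ y = ∑ b, y b • fderiv ℝ A ξ (EuclideanSpace.single b 1) := by
    conv_lhs => rw [← (EuclideanSpace.basisFun (Fin n × Fin N) ℝ).sum_repr y]
    simp
  rw [hy, PiLp.inner_apply]
  refine Finset.sum_congr rfl fun a _ => ?_
  simp only [dA, WithLp.ofLp_sum, Finset.sum_apply, WithLp.ofLp_smul, Pi.smul_apply,
    smul_eq_mul, RCLike.inner_apply, conj_trivial, Finset.sum_mul]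
  exact Finset.sum_congr rfl fun b _ => by ring

lemma EllipticGrowth.le_inner (hA : EllipticGrowth n N p q m M A) (ξ x : Vec n N) :
    m * (1 + ‖ξ‖ ^ 2) ^ ((p - 2) / 2) * ‖x‖ ^ 2 ≤ inner ℝ x (fderiv ℝ A ξ x) := by
  refine (hA.ellipticity ξ x).trans_eq ?_
  rw [inner_fderiv_eq]
  simp only [Fintype.sum_prod_type]
  exact Finset.sum_congr rfl fun i _ => Finset.sum_comm

lemma EllipticGrowth.abs_inner_le (hA : EllipticGrowth n N p q m M A) (ξ x y : Vec n N) :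
    |inner ℝ x (fderiv ℝ A ξ y)| ≤
      M * (1 + ‖ξ‖ ^ 2) ^ ((q - 2) / 2) * (n * N : ℝ) ^ 2 * (‖x‖ * ‖y‖) := by
  rw [inner_fderiv_eq]
  simpa using abs_bilinear_sum_le (fun a b => hA.growth ξ a.1 a.2 b.1 b.2) x y

lemma SkewControl.abs_inner_sub_le (hA : SkewControl n N p q M A) (ξ x y : Vec n N) :
    |inner ℝ x (fderiv ℝ A ξ y) - inner ℝ y (fderiv ℝ A ξ x)| ≤
      M * (1 + ‖ξ‖ ^ 2) ^ ((q + p - 4) / 4) * (n * N : ℝ) ^ 2 * (‖x‖ * ‖y‖) := by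
  have h : inner ℝ x (fderiv ℝ A ξ y) - inner ℝ y (fderiv ℝ A ξ x) =
      ∑ a : Fin n × Fin N, ∑ b : Fin n × Fin N,
        (dA A ξ a.1 a.2 b.1 b.2 - dA A ξ b.1 b.2 a.1 a.2) * x a * y b := by
    rw [inner_fderiv_eq, inner_fderiv_eq A ξ y x, Finset.sum_comm (f := fun a b =>
      dA A ξ a.1 a.2 b.1 b.2 * y a * x b), ← Finset.sum_sub_distrib]
    refine Finset.sum_congr rfl fun a _ => ?_
    rw [← Finset.sum_sub_distrib]
    exact Finset.sum_congr rfl fun b _ => by ring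
  rw [h]
  simpa using abs_bilinear_sum_le (fun a b => hA ξ a.1 a.2 b.1 b.2) x y

/-- The pointwise inequality behind the second order Caccioppoli estimate. -/
lemma EllipticGrowth.caccioppoli_pointwise (hm : 0 < m) (hA : EllipticGrowth n N p q m M A)
    (hS : SkewControl n N p q M A) (ξ x y : Vec n N) :
    m / 4 * ((1 + ‖ξ‖ ^ 2) ^ ((p - 2) / 2) * ‖x‖ ^ 2) -
      (2 * (M * (n * N : ℝ) ^ 2) + (M * (n * N : ℝ) ^ 2) ^ 2 / m) *
        ((1 + ‖ξ‖ ^ 2) ^ ((q - 2) / 2) * ‖y‖ ^ 2) ≤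
      inner ℝ x (fderiv ℝ A ξ x) + 2 * inner ℝ y (fderiv ℝ A ξ x) := by
  have hH : (0 : ℝ) < 1 + ‖ξ‖ ^ 2 := by positivity
  set a := (1 + ‖ξ‖ ^ 2) ^ ((p - 2) / 4) with ha
  set b := (1 + ‖ξ‖ ^ 2) ^ ((q - 2) / 4) with hb
  have haa : (1 + ‖ξ‖ ^ 2) ^ ((p - 2) / 2) = a ^ 2 := by
    rw [ha, ← Real.rpow_mul_natCast hH.le]; congr 1; push_cast; ring
  have hbb : (1 + ‖ξ‖ ^ 2) ^ ((q - 2) / 2) = b ^ 2 := by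
    rw [hb, ← Real.rpow_mul_natCast hH.le]; congr 1; push_cast; ring
  have hab : (1 + ‖ξ‖ ^ 2) ^ ((q + p - 4) / 4) = a * b := by
    rw [ha, hb, ← Real.rpow_add hH]; congr 1; ring
  have hell := hA.le_inner ξ x
  have hpos := hA.le_inner ξ (x + (2 : ℝ) • y)
  have hyy := (abs_le.1 (hA.abs_inner_le ξ y y)).2
  have hsk := (abs_le.1 (hS.abs_inner_sub_le ξ y x)).1
  have hpos' : 0 ≤ inner ℝ (x + (2 : ℝ) • y) (fderiv ℝ A ξ (x + (2 : ℝ) • y)) :=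
    le_trans (by positivity) hpos
  simp only [map_add, map_smul, inner_add_left, inner_add_right, inner_smul_left,
    inner_smul_right, conj_trivial] at hpos'
  rw [haa] at hell ⊢
  rw [hbb] at hyy ⊢
  rw [hab] at hsk
  set k := M * (n * N : ℝ) ^ 2 with hk
  have hcs : k * (a * ‖x‖) * (b * ‖y‖) ≤ m / 4 * (a * ‖x‖) ^ 2 + k ^ 2 / m * (b * ‖y‖) ^ 2 := by
    have := sq_nonneg (m / 2 * (a * ‖x‖) - k * (b * ‖y‖))
    have h2 : m / 4 * (a * ‖x‖) ^ 2 + k ^ 2 / m * (b * ‖y‖) ^ 2 - k * (a * ‖x‖) * (b * ‖y‖) =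
      (m / 2 * (a * ‖x‖) - k * (b * ‖y‖)) ^ 2 / m := by field_simp; ring
    have := div_nonneg this hm.le
    linarith
  have e1 : M * (a * b) * (n * N : ℝ) ^ 2 * (‖y‖ * ‖x‖) = k * (a * ‖x‖) * (b * ‖y‖) := by
    rw [hk]; ring
  have e2 : M * b ^ 2 * (n * N : ℝ) ^ 2 * (‖y‖ * ‖y‖) = k * (b * ‖y‖) ^ 2 := by rw [hk]; ring
  rw [e1] at hsk
  rw [e2] at hyy
  nlinarith

end Structure

section Caccioppoli

variable {n N : ℕ} {p q m M : ℝ} {A : Vec n N → Vec n N}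
  {u : Pt n → EuclideanSpace ℝ (Fin N)} {U : Set (Pt n)}

lemma continuous_one_add_grad_rpow (hu : ContDiff ℝ 2 u) (r : ℝ) :
    Continuous fun x => (1 + ‖grad u x‖ ^ 2) ^ r :=
  (continuous_const.add ((contDiff_grad hu).continuous.norm.pow 2)).rpow_const fun x =>
    Or.inl (by positivity : (0 : ℝ) < 1 + ‖grad u x‖ ^ 2).ne'

lemma EllipticGrowth.fderiv_comp_grad (hA : EllipticGrowth n N p q m M A)
    (hu : ContDiff ℝ 2 u) (x y : Pt n) (a : Fin n × Fin N) :
    fderiv ℝ (fun z => A (grad u z) a) x y =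
      fderiv ℝ A (grad u x) (fderiv ℝ (grad u) x y) a := by
  have hd := (contDiff_grad hu).differentiable one_ne_zero x
  rw [fderiv_euclidean_apply (f := fun z => A (grad u z)) ((hA.differentiable _).comp x hd),
    fderiv_fun_comp x (hA.differentiable _) hd]
  rfl

lemma EllipticGrowth.locallyIntegrable_flux_deriv (hA : EllipticGrowth n N p q m M A)
    (hu : ContDiff ℝ 2 u) (s : Fin n) (a : Fin n × Fin N) :
    LocallyIntegrable fun x =>
      fderiv ℝ (fun z => A (grad u z) a) x (EuclideanSpace.single s 1) := by
  have hG : Continuous fun x => M * (1 + ‖grad u x‖ ^ 2) ^ ((q - 2) / 2) * (n * N : ℝ) ^ 2 *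
      (1 * ‖fderiv ℝ (grad u) x (EuclideanSpace.single s 1)‖) :=
    (((continuous_one_add_grad_rpow hu _).const_mul M).mul_const _).mul
      ((continuous_hess hu s).norm.const_mul 1)
  refine (hG.locallyIntegrable (μ := volume)).mono
    (measurable_fderiv_apply_const ℝ _ _).aestronglyMeasurable
    (Filter.Eventually.of_forall fun x => ?_)
  rw [hA.fderiv_comp_grad hu, Real.norm_eq_abs, Real.norm_eq_abs]
  have h := hA.abs_inner_le (grad u x) (EuclideanSpace.single a 1)
    (fderiv ℝ (grad u) x (EuclideanSpace.single s 1))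
  rw [EuclideanSpace.inner_single_left] at h
  simp only [map_one, one_mul, PiLp.norm_single, norm_one] at h ⊢
  exact h.trans (le_abs_self _)

/-- Differentiating the weak equation, tested with smooth functions. -/
lemma EllipticGrowth.integral_flux_deriv_smooth (hA : EllipticGrowth n N p q m M A)
    (hu : ContDiff ℝ 2 u)
    (hw : ∀ α, ∀ g : Pt n → ℝ, ContDiff ℝ ∞ g → HasCompactSupport g → tsupport g ⊆ U →
      ∫ x, ∑ i, A (grad u x) (i, α) * fderiv ℝ g x (EuclideanSpace.single i 1) = 0)
    (s : Fin n) (α : Fin N) {g : Pt n → ℝ} (hg : ContDiff ℝ ∞ g) (hgc : HasCompactSupport g)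
    (hgU : tsupport g ⊆ U) :
    ∫ x, ∑ i, fderiv ℝ (fun z => A (grad u z) (i, α)) x (EuclideanSpace.single s 1) *
      fderiv ℝ g x (EuclideanSpace.single i 1) = 0 := by
  have hdg : ∀ i : Fin n, ContDiff ℝ ∞ fun x => fderiv ℝ g x (EuclideanSpace.single i 1) :=
    fun i => (hg.fderiv_right (m := ∞) (by norm_cast)).clm_apply contDiff_const
  have hdgc : ∀ i : Fin n, HasCompactSupport fun x => fderiv ℝ g x (EuclideanSpace.single i 1) :=
    fun i => hgc.fderiv_apply ℝ _
  have hdgU : tsupport (fun x => fderiv ℝ g x (EuclideanSpace.single s 1)) ⊆ U :=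
    (tsupport_fderiv_apply_subset ℝ _).trans hgU
  have h2g : ∀ i : Fin n, Continuous fun x => fderiv ℝ
      (fun y => fderiv ℝ g y (EuclideanSpace.single i 1)) x (EuclideanSpace.single s 1) :=
    fun i => ((hdg i).continuous_fderiv (by simp)).clm_apply continuous_const
  have hwc : ∀ i, Continuous fun x => A (grad u x) (i, α) := fun i =>
    (EuclideanSpace.proj (i, α)).continuous.comp
      (hA.differentiable.continuous.comp (contDiff_grad hu).continuous)
  have hwd : ∀ i, Differentiable ℝ fun x => A (grad u x) (i, α) := fun i =>
    (EuclideanSpace.proj (𝕜 := ℝ) (i, α)).differentiable.comp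
      (hA.differentiable.comp ((contDiff_grad hu).differentiable one_ne_zero))
  have hint1 : ∀ i, Integrable fun x =>
      fderiv ℝ (fun z => A (grad u z) (i, α)) x (EuclideanSpace.single s 1) *
        fderiv ℝ g x (EuclideanSpace.single i 1) := fun i => by
    simpa [mul_comm] using
      (hA.locallyIntegrable_flux_deriv hu s (i, α)).integrable_smul_left_of_hasCompactSupport
        (hdg i).continuous (hdgc i)
  have hint2 : ∀ i, Integrable fun x => A (grad u x) (i, α) * fderiv ℝ
      (fun y => fderiv ℝ g y (EuclideanSpace.single i 1)) x (EuclideanSpace.single s 1) :=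
    fun i => ((hwc i).mul (h2g i)).integrable_of_hasCompactSupport
      (((hdgc i).fderiv_apply ℝ _).mul_left)
  have hparts : ∀ i, ∫ x, fderiv ℝ (fun z => A (grad u z) (i, α)) x (EuclideanSpace.single s 1) *
        fderiv ℝ g x (EuclideanSpace.single i 1) =
      -∫ x, A (grad u x) (i, α) * fderiv ℝ
      (fun y => fderiv ℝ g y (EuclideanSpace.single i 1)) x (EuclideanSpace.single s 1) := by
    intro i
    rw [integral_mul_fderiv_eq_neg_fderiv_mul_of_integrable (hint1 i) (hint2 i)
      (((hwc i).mul (hdg i).continuous).integrable_of_hasCompactSupport ((hdgc i).mul_left))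
      (fun x _ => hwd i x) (fun x _ => (hdg i).differentiable (by simp) x), neg_neg]
  have hsymm : ∀ i x, fderiv ℝ
      (fun y => fderiv ℝ g y (EuclideanSpace.single i 1)) x (EuclideanSpace.single s 1) =
      fderiv ℝ (fun y => fderiv ℝ g y (EuclideanSpace.single s 1)) x
        (EuclideanSpace.single i 1) := by
    intro i x
    have h2 : DifferentiableAt ℝ (fderiv ℝ g) x :=
      (hg.fderiv_right (m := 1) (by norm_cast)).differentiable one_ne_zero x
    have hs : IsSymmSndFDerivAt ℝ g x :=
      (contDiff_infty.1 hg 2).contDiffAt.isSymmSndFDerivAt (by simp)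
    rw [fderiv_clm_apply h2 (differentiableAt_const _),
      fderiv_clm_apply h2 (differentiableAt_const _)]
    simpa using hs.eq _ _
  have h0 := hw α _ (hdg s) (hdgc s) hdgU
  rw [integral_finsetSum _ fun i _ => hint1 i, Finset.sum_congr rfl fun i _ => hparts i,
    Finset.sum_neg_distrib, ← integral_finsetSum _ fun i _ => hint2 i]
  simp only [hsymm, h0, neg_zero]

/-- The second order Caccioppoli inequality. -/
lemma EllipticGrowth.caccioppoli (hm : 0 < m) (hM : 0 < M) (hA : EllipticGrowth n N p q m M A)
    (hS : SkewControl n N p q M A) (hu : ContDiff ℝ 2 u) (hU : IsOpen U)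
    (hw : ∀ α, ∀ g : Pt n → ℝ, ContDiff ℝ ∞ g → HasCompactSupport g → tsupport g ⊆ U →
      ∫ x, ∑ i, A (grad u x) (i, α) * fderiv ℝ g x (EuclideanSpace.single i 1) = 0)
    {ζ : Pt n → ℝ} (hζ : ContDiff ℝ ∞ ζ) (hζc : HasCompactSupport ζ) (hζU : tsupport ζ ⊆ U) :
    m / 4 * ∫ x, ζ x ^ 2 * ((1 + ‖grad u x‖ ^ 2) ^ ((p - 2) / 2) * hessSq u x) ≤
      (2 * (M * (n * N : ℝ) ^ 2) + (M * (n * N : ℝ) ^ 2) ^ 2 / m) * n *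
        ∫ x, ‖fderiv ℝ ζ x‖ ^ 2 * (1 + ‖grad u x‖ ^ 2) ^ (q / 2) := by
  set c := 2 * (M * (n * N : ℝ) ^ 2) + (M * (n * N : ℝ) ^ 2) ^ 2 / m with hc
  have hc0 : 0 ≤ c := by positivity
  have hζ1 : ContDiff ℝ 1 ζ := hζ.of_le (by exact_mod_cast le_top)
  have hgr := contDiff_grad hu
  have hgd : ∀ a, Differentiable ℝ fun x => grad u x a := fun a =>
    (EuclideanSpace.proj (𝕜 := ℝ) a).differentiable.comp (hgr.differentiable one_ne_zero)
  set g : Fin n → Fin N → Pt n → ℝ := fun s α x => ζ x ^ 2 * grad u x (s, α) with hgdef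
  have hg1 : ∀ s α, ContDiff ℝ 1 (g s α) := fun s α =>
    (hζ1.pow 2).mul (contDiff_euclidean.1 hgr (s, α))
  have hgsupp : ∀ s α, tsupport (g s α) ⊆ tsupport ζ := fun s α =>
    closure_mono fun x hx hx0 => hx (by simp [hgdef, hx0])
  have hgc : ∀ s α, HasCompactSupport (g s α) := fun s α =>
    hζc.of_isClosed_subset (isClosed_tsupport _) (hgsupp s α)
  have hdg : ∀ s α i x, fderiv ℝ (g s α) x (EuclideanSpace.single i 1) =
      ζ x ^ 2 * fderiv ℝ (grad u) x (EuclideanSpace.single s 1) (i, α) +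
        2 * ζ x * (fderiv ℝ ζ x (EuclideanSpace.single i 1) * grad u x (s, α)) := by
    intro s α i x
    have hζd := hζ1.differentiable one_ne_zero x
    have h1 : fderiv ℝ (fun y => ζ y ^ 2) x = (2 * ζ x) • fderiv ℝ ζ x := by
      simpa using (hζd.hasFDerivAt.pow 2).fderiv
    have h2 := fderiv_fun_mul (c := fun y => ζ y ^ 2) (hζd.pow 2) (hgd (s, α) x)
    simp only [hgdef, h2]
    simp only [add_apply, smul_apply, smul_eq_mul]
    rw [fderiv_euclidean_apply (hgr.differentiable one_ne_zero x), fderiv_grad_symm hu x i s, h1]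
    simp only [smul_apply, smul_eq_mul]
    ring
  have hzero : ∀ s α, ∫ x, ∑ i, fderiv ℝ (fun z => A (grad u z) (i, α)) x
      (EuclideanSpace.single s 1) * fderiv ℝ (g s α) x (EuclideanSpace.single i 1) = 0 :=
    fun s α => integral_sum_mul_fderiv_eq_zero hU
      (fun i => hA.locallyIntegrable_flux_deriv hu s (i, α))
      (fun f hf hfc hfU => hA.integral_flux_deriv_smooth hu hw s α hf hfc hfU)
      (hg1 s α) (hgc s α) ((hgsupp s α).trans hζU)
  have hint : ∀ s α, Integrable fun x => ∑ i, fderiv ℝ (fun z => A (grad u z) (i, α)) x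
      (EuclideanSpace.single s 1) * fderiv ℝ (g s α) x (EuclideanSpace.single i 1) := by
    refine fun s α => integrable_finsetSum _ fun i _ => ?_
    simpa [mul_comm] using
      (hA.locallyIntegrable_flux_deriv hu s (i, α)).integrable_smul_left_of_hasCompactSupport
        (g := fun x => fderiv ℝ (g s α) x (EuclideanSpace.single i 1))
        (((hg1 s α).continuous_fderiv one_ne_zero).clm_apply continuous_const)
        ((hgc s α).fderiv_apply ℝ _)
  set Y : Pt n → ℝ := fun x => ζ x ^ 2 * ((1 + ‖grad u x‖ ^ 2) ^ ((p - 2) / 2) * hessSq u x)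
  set Z : Pt n → ℝ := fun x => ‖fderiv ℝ ζ x‖ ^ 2 * (1 + ‖grad u x‖ ^ 2) ^ (q / 2)
  have hY : Integrable Y := by
    refine Continuous.integrable_of_hasCompactSupport ?_ ?_
    · exact (hζ.continuous.pow 2).mul
        ((continuous_one_add_grad_rpow hu _).mul (continuous_hessSq hu))
    · exact HasCompactSupport.mul_right (hζc.comp_left (g := fun t : ℝ => t ^ 2) (by simp))
  have hZ : Integrable Z := by
    refine Continuous.integrable_of_hasCompactSupport ?_ ?_
    · exact ((hζ1.continuous_fderiv one_ne_zero).norm.pow 2).mul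
        (continuous_one_add_grad_rpow hu _)
    · exact HasCompactSupport.mul_right
        ((hζc.fderiv ℝ).comp_left (g := fun T : Pt n →L[ℝ] ℝ => ‖T‖ ^ 2) (by simp))
  have hpt : ∀ x, m / 4 * Y x - c * n * Z x ≤ ∑ s, ∑ α, ∑ i,
      fderiv ℝ (fun z => A (grad u z) (i, α)) x (EuclideanSpace.single s 1) *
        fderiv ℝ (g s α) x (EuclideanSpace.single i 1) := by
    intro x
    set H := 1 + ‖grad u x‖ ^ 2 with hH
    have hH0 : 0 < H := by positivity
    set D := fun s => fderiv ℝ (grad u) x (EuclideanSpace.single s 1) with hD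
    let y : Fin n → Vec n N := fun s => WithLp.toLp 2 fun a =>
      fderiv ℝ ζ x (EuclideanSpace.single a.1 1) * grad u x (s, a.2)
    have hs : ∀ s, m / 4 * (H ^ ((p - 2) / 2) * ‖ζ x • D s‖ ^ 2) -
        c * (H ^ ((q - 2) / 2) * ‖y s‖ ^ 2) ≤ ∑ α, ∑ i,
      fderiv ℝ (fun z => A (grad u z) (i, α)) x (EuclideanSpace.single s 1) *
        fderiv ℝ (g s α) x (EuclideanSpace.single i 1) := by
      intro s
      refine (hA.caccioppoli_pointwise hm hS (grad u x) (ζ x • D s) (y s)).trans_eq ?_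
      rw [PiLp.inner_apply, PiLp.inner_apply, Finset.mul_sum, ← Finset.sum_add_distrib,
        Fintype.sum_prod_type, Finset.sum_comm]
      refine Finset.sum_congr rfl fun α _ => Finset.sum_congr rfl fun i _ => ?_
      rw [hdg, hA.fderiv_comp_grad hu]
      simp [y, hD]
      ring
    have hysum : ∑ s, ‖y s‖ ^ 2 ≤ n * (‖fderiv ℝ ζ x‖ ^ 2 * ‖grad u x‖ ^ 2) := by
      have h1 : ∀ s i α, (y s (i, α)) ^ 2 ≤ ‖fderiv ℝ ζ x‖ ^ 2 * grad u x (s, α) ^ 2 := by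
        intro s i α
        have : |fderiv ℝ ζ x (EuclideanSpace.single i 1)| ≤ ‖fderiv ℝ ζ x‖ := by
          simpa using (fderiv ℝ ζ x).le_opNorm (EuclideanSpace.single i 1)
        have h2 := sq_le_sq' (neg_le_of_abs_le this) (le_of_abs_le this)
        simp only [y, mul_pow]
        exact mul_le_mul_of_nonneg_right h2 (sq_nonneg _)
      calc ∑ s, ‖y s‖ ^ 2 = ∑ s, ∑ i, ∑ α, (y s (i, α)) ^ 2 := by
            simp only [EuclideanSpace.norm_sq_eq, Fintype.sum_prod_type, Real.norm_eq_abs, sq_abs]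
        _ ≤ ∑ s, ∑ i : Fin n, ∑ α, ‖fderiv ℝ ζ x‖ ^ 2 * grad u x (s, α) ^ 2 :=
            Finset.sum_le_sum fun s _ => Finset.sum_le_sum fun i _ =>
              Finset.sum_le_sum fun α _ => h1 s i α
        _ = _ := by
            simp only [Finset.sum_const, Finset.card_univ, Fintype.card_fin, nsmul_eq_mul,
              ← Finset.mul_sum, EuclideanSpace.norm_sq_eq, Fintype.sum_prod_type,
              Real.norm_eq_abs, sq_abs]
    have hHq : H ^ ((q - 2) / 2) * ‖grad u x‖ ^ 2 ≤ H ^ (q / 2) := by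
      have h3 : H ^ (q / 2) = H ^ ((q - 2) / 2) * H := by
        conv_rhs => rw [← Real.rpow_add_one hH0.ne']
        congr 1; ring
      rw [h3]
      exact mul_le_mul_of_nonneg_left (by rw [hH]; linarith) (by positivity)
    refine le_trans ?_ (Finset.sum_le_sum fun s _ => hs s)
    have hYx : Y x = H ^ ((p - 2) / 2) * ∑ s, ‖ζ x • D s‖ ^ 2 := by
      simp only [Y, hessSq_eq hu, norm_smul, mul_pow, ← Finset.mul_sum, Real.norm_eq_abs, sq_abs]
      ring
    rw [Finset.sum_sub_distrib, ← Finset.mul_sum, ← Finset.mul_sum, ← Finset.mul_sum,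
      ← Finset.mul_sum, ← hYx, mul_assoc]
    refine sub_le_sub_left (mul_le_mul_of_nonneg_left ?_ hc0) _
    calc H ^ ((q - 2) / 2) * ∑ s, ‖y s‖ ^ 2 ≤
          H ^ ((q - 2) / 2) * (n * (‖fderiv ℝ ζ x‖ ^ 2 * ‖grad u x‖ ^ 2)) :=
          mul_le_mul_of_nonneg_left hysum (by positivity)
      _ = n * (‖fderiv ℝ ζ x‖ ^ 2 * (H ^ ((q - 2) / 2) * ‖grad u x‖ ^ 2)) := by ring
      _ ≤ n * Z x := by
          simp only [Z]
          gcongr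
  have hle := integral_mono ((hY.const_mul (m / 4)).sub (hZ.const_mul (c * n)))
    (integrable_finsetSum _ fun s _ => integrable_finsetSum _ fun α _ => hint s α) hpt
  rw [integral_finsetSum _ fun s _ => integrable_finsetSum _ fun α _ => hint s α,
    Finset.sum_eq_zero fun s _ => by
      rw [integral_finsetSum _ fun α _ => hint s α, Finset.sum_eq_zero fun α _ => hzero s α]] at hle
  simp only [Pi.sub_apply] at hle
  rw [integral_sub (hY.const_mul _) (hZ.const_mul _), integral_const_mul, integral_const_mul] at hle
  linarith

end Caccioppoli

section Interpolation

variable {n N : ℕ} {u : Pt n → EuclideanSpace ℝ (Fin N)}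

lemma hasFDerivAt_one_add_grad_rpow_mul (hu : ContDiff ℝ 2 u) (r : ℝ) (a : Fin n × Fin N)
    (x : Pt n) :
    HasFDerivAt (fun y => (1 + ‖grad u y‖ ^ 2) ^ r * grad u y a)
      ((1 + ‖grad u x‖ ^ 2) ^ r • fderiv ℝ (fun y => grad u y a) x +
        grad u x a • ((r * (1 + ‖grad u x‖ ^ 2) ^ (r - 1)) •
          (2 • (innerSL ℝ (grad u x)).comp (fderiv ℝ (grad u) x)))) x := by
  have hd := ((contDiff_grad hu).differentiable one_ne_zero x).hasFDerivAt
  have hH : HasFDerivAt (fun y => 1 + ‖grad u y‖ ^ 2)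
      (2 • (innerSL ℝ (grad u x)).comp (fderiv ℝ (grad u) x)) x :=
    hd.norm_sq.const_add 1
  have hc : HasFDerivAt (fun y => grad u y a) (fderiv ℝ (fun y => grad u y a) x) x :=
    ((EuclideanSpace.proj (𝕜 := ℝ) a).differentiableAt.comp x
      ((contDiff_grad hu).differentiable one_ne_zero x)).hasFDerivAt
  exact (hH.rpow_const (Or.inl (by positivity : (0 : ℝ) < 1 + ‖grad u x‖ ^ 2).ne')).mul hc

lemma norm_le_sqrt_one_add_sq {E : Type*} [NormedAddCommGroup E] (ξ : E) :
    ‖ξ‖ ≤ √(1 + ‖ξ‖ ^ 2) :=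
  Real.le_sqrt_of_sq_le (by linarith)

/-- Derivative bound for `(1 + |Du|²)^{p/2} Du`. -/
lemma abs_fderiv_rpow_mul_grad_le (hu : ContDiff ℝ 2 u) {p : ℝ} (hp : 0 ≤ p)
    (a : Fin n × Fin N) (x : Pt n) (s : Fin n) :
    |fderiv ℝ (fun y => (1 + ‖grad u y‖ ^ 2) ^ (p / 2) * grad u y a) x
      (EuclideanSpace.single s 1)| ≤
      (p + 1) * (1 + ‖grad u x‖ ^ 2) ^ (p / 2) * √(hessSq u x) := by
  rw [(hasFDerivAt_one_add_grad_rpow_mul hu (p / 2) a x).fderiv]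
  simp only [add_apply, smul_apply, smul_eq_mul, ContinuousLinearMap.comp_apply,
    innerSL_apply_apply, nsmul_eq_mul, Nat.cast_ofNat]
  rw [fderiv_euclidean_apply ((contDiff_grad hu).differentiable one_ne_zero x)]
  set H := 1 + ‖grad u x‖ ^ 2 with hH
  have hH0 : 0 < H := by positivity
  set D := fderiv ℝ (grad u) x (EuclideanSpace.single s 1)
  have hD : ‖D‖ ≤ √(hessSq u x) := norm_hess_le_sqrt hu x s
  have h1 : |D a| ≤ √(hessSq u x) := (PiLp.norm_apply_le D a).trans hD
  have h2 : |inner ℝ (grad u x) D| ≤ √H * √(hessSq u x) :=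
    (abs_real_inner_le_norm _ _).trans
      (mul_le_mul (norm_le_sqrt_one_add_sq _) hD (norm_nonneg _) (Real.sqrt_nonneg _))
  have h3 : |grad u x a| ≤ √H :=
    (PiLp.norm_apply_le (grad u x) a).trans (norm_le_sqrt_one_add_sq _)
  have h4 : H ^ (p / 2) = H ^ (p / 2 - 1) * H := by
    rw [← Real.rpow_add_one hH0.ne']; congr 1; ring
  have h5 : √H * √H = H := Real.mul_self_sqrt hH0.le
  have hpow : 0 ≤ H ^ (p / 2 - 1) := by positivity
  calc |H ^ (p / 2) * D a + grad u x a * (p / 2 * H ^ (p / 2 - 1) * (2 * inner ℝ (grad u x) D))|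
      ≤ H ^ (p / 2) * |D a| +
        |grad u x a| * (p * H ^ (p / 2 - 1) * |inner ℝ (grad u x) D|) := by
        refine (abs_add_le _ _).trans_eq ?_
        rw [abs_mul, abs_mul, abs_mul, abs_mul, abs_mul, abs_of_nonneg hpow,
          abs_of_nonneg (by positivity : 0 ≤ H ^ (p / 2)),
          abs_of_nonneg (by positivity : 0 ≤ p / 2), abs_two]
        ring
    _ ≤ H ^ (p / 2) * √(hessSq u x) +
        √H * (p * H ^ (p / 2 - 1) * (√H * √(hessSq u x))) := by gcongr
    _ = H ^ (p / 2) * √(hessSq u x) +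
        p * (H ^ (p / 2 - 1) * (√H * √H)) * √(hessSq u x) := by ring
    _ = (p + 1) * H ^ (p / 2) * √(hessSq u x) := by rw [h5, ← h4]; ring

lemma interpolation_pointwise {p q κ b z t d H h : ℝ} (hpq : p ≤ q) (hb : 0 ≤ b)
    (hH : 1 ≤ H) (hh : 0 ≤ h) (hz : 0 ≤ z) (hzt : z ≤ t) (hd : d ≤ κ * t) :
    z ^ 2 * H ^ ((p + 2) / 2) +
      b * (2 * z * d * (H ^ (p / 2) * √H) + z ^ 2 * ((p + 1) * H ^ (p / 2) * √h)) ≤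
    z ^ 2 * (H ^ (p / 2) * (H - 1)) + (1 / 2 * (z ^ 2 * H ^ ((p + 2) / 2)) +
      (1 + (2 * κ * b) ^ 2) * (t ^ 2 * H ^ (q / 2)) +
      ((p + 1) * b) ^ 2 * (z ^ 2 * (H ^ ((p - 2) / 2) * h))) := by
  have hH0 : 0 < H := one_pos.trans_le hH
  have hX : H ^ ((p + 2) / 2) = H ^ (p / 2) * H := by
    rw [← Real.rpow_add_one hH0.ne']; congr 1; ring
  have hY : H ^ ((p - 2) / 2) * h = H ^ (p / 2) * (h / H) := by
    rw [show (p - 2) / 2 = p / 2 - 1 by ring, Real.rpow_sub_one hH0.ne']; ring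
  have hZ : t ^ 2 * H ^ (p / 2) ≤ t ^ 2 * H ^ (q / 2) :=
    mul_le_mul_of_nonneg_left (Real.rpow_le_rpow_of_exponent_le hH (by linarith)) (sq_nonneg _)
  rw [hX, hY]
  set P := H ^ (p / 2)
  have hP0 : 0 < P := Real.rpow_pos_of_pos hH0 _
  have hsH : √H ^ 2 = H := Real.sq_sqrt hH0.le
  have hsH0 : 0 < √H := Real.sqrt_pos.2 hH0
  have hfirst : b * (2 * z * d * √H) ≤ 1 / 4 * (z ^ 2 * H) + (2 * κ * b) ^ 2 * t ^ 2 := by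
    calc b * (2 * z * d * √H) ≤ b * (2 * z * (κ * t) * √H) := by gcongr
      _ = (z * √H) * (2 * κ * b * t) := by ring
      _ ≤ 1 / 4 * (z * √H) ^ 2 + (2 * κ * b * t) ^ 2 := by
          nlinarith [sq_nonneg (1 / 2 * (z * √H) - 2 * κ * b * t)]
      _ = _ := by rw [mul_pow z, hsH, mul_pow _ t]
  have hsecond : (p + 1) * b * √h ≤ 1 / 4 * H + ((p + 1) * b) ^ 2 * (h / H) := by
    have h1 : (p + 1) * b * √h = √H * ((p + 1) * b * (√h / √H)) := by field_simp
    have h2 : h / H = (√h / √H) ^ 2 := by rw [div_pow, hsH, Real.sq_sqrt hh]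
    rw [h1, h2, ← mul_pow]
    nlinarith [sq_nonneg (1 / 2 * √H - (p + 1) * b * (√h / √H))]
  have h1 := mul_le_mul_of_nonneg_left hfirst hP0.le
  have h2 := mul_le_mul_of_nonneg_left
    (mul_le_mul_of_nonneg_left hsecond (sq_nonneg z)) hP0.le
  have h3 : z ^ 2 * P ≤ t ^ 2 * P :=
    mul_le_mul_of_nonneg_right (pow_le_pow_left₀ hz hzt 2) hP0.le
  have h4 := mul_le_mul_of_nonneg_left hZ (by positivity : 0 ≤ 1 + (2 * κ * b) ^ 2)
  linarith

/-- Integration by parts against a bounded function, one component at a time. -/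
lemma integral_rpow_mul_grad_sq_le (hu : ContDiff ℝ 2 u) {B : ℝ} (hB : ∀ x, ‖u x‖ ≤ B)
    {p : ℝ} (hp : 0 ≤ p) {ζ E : Pt n → ℝ} (hζ : ContDiff ℝ 1 ζ) (hζc : HasCompactSupport ζ)
    (hζ0 : ∀ x, 0 ≤ ζ x) (hEint : Integrable E)
    (hE : ∀ x, B * (2 * ζ x * ‖fderiv ℝ ζ x‖ *
        ((1 + ‖grad u x‖ ^ 2) ^ (p / 2) * √(1 + ‖grad u x‖ ^ 2)) +
      ζ x ^ 2 * ((p + 1) * (1 + ‖grad u x‖ ^ 2) ^ (p / 2) * √(hessSq u x))) = E x)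
    (a : Fin n × Fin N) :
    Integrable (fun x => ζ x ^ 2 * ((1 + ‖grad u x‖ ^ 2) ^ (p / 2) * grad u x a ^ 2)) ∧
      ∫ x, ζ x ^ 2 * ((1 + ‖grad u x‖ ^ 2) ^ (p / 2) * grad u x a ^ 2) ≤ ∫ x, E x := by
  have hgr := contDiff_grad hu
  have hsq : HasCompactSupport fun x => ζ x ^ 2 :=
    hζc.comp_left (g := fun y : ℝ => y ^ 2) (by simp)
  have hB0 : 0 ≤ B := (norm_nonneg _).trans (hB 0)
  set H : Pt n → ℝ := fun x => 1 + ‖grad u x‖ ^ 2 with hH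
  have hH0 : ∀ x, 0 < H x := fun x => by positivity
  set G : Pt n → ℝ := fun x => H x ^ (p / 2) * grad u x a with hG
  have hGd : Differentiable ℝ G := fun x =>
    (hasFDerivAt_one_add_grad_rpow_mul hu (p / 2) a x).differentiableAt
  have hac : Continuous fun x => grad u x a :=
    (EuclideanSpace.proj (𝕜 := ℝ) a).continuous.comp hgr.continuous
  have hG1 : ContDiff ℝ 1 G := by
    refine ContDiff.mul (ContDiff.rpow_const_of_ne ?_ fun x => (hH0 x).ne')
      (contDiff_euclidean.1 hgr a)
    exact contDiff_const.add (hgr.norm_sq ℝ)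
  have huα : ContDiff ℝ 2 fun x => u x a.2 := contDiff_euclidean.1 hu a.2
  have hf1 : ContDiff ℝ 1 fun x => ζ x ^ 2 * G x := (hζ.pow 2).mul hG1
  have hdu : ∀ x, fderiv ℝ (fun y => u y a.2) x (EuclideanSpace.single a.1 1) =
      grad u x a := fun x =>
    fderiv_euclidean_apply (hu.differentiable two_ne_zero x) _ _
  have hdf : ∀ x, ‖fderiv ℝ (fun y => ζ y ^ 2 * G y) x (EuclideanSpace.single a.1 1) *
      u x a.2‖ ≤ E x := by
    intro x
    rw [← hE]
    have hζd := hζ.differentiable one_ne_zero x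
    have h1 : fderiv ℝ (fun y => ζ y ^ 2) x = (2 * ζ x) • fderiv ℝ ζ x := by
      simpa using (hζd.hasFDerivAt.pow 2).fderiv
    have h2 := fderiv_fun_mul (c := fun y => ζ y ^ 2) (hζd.pow 2) (hGd x)
    have h3 := abs_fderiv_rpow_mul_grad_le hu hp a x a.1
    have h4 : |fderiv ℝ ζ x (EuclideanSpace.single a.1 1)| ≤ ‖fderiv ℝ ζ x‖ := by
      simpa using (fderiv ℝ ζ x).le_opNorm (EuclideanSpace.single a.1 1)
    have h5 : |G x| ≤ H x ^ (p / 2) * √(H x) := by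
      rw [hG, abs_mul, abs_of_nonneg (Real.rpow_nonneg (hH0 x).le _)]
      exact mul_le_mul_of_nonneg_left
        ((PiLp.norm_apply_le (grad u x) a).trans (norm_le_sqrt_one_add_sq _))
        (Real.rpow_nonneg (hH0 x).le _)
    have h6 : ‖u x a.2‖ ≤ B := (PiLp.norm_apply_le _ _).trans (hB x)
    rw [norm_mul, mul_comm, h2, h1]
    simp only [add_apply, smul_apply, smul_eq_mul]
    refine mul_le_mul h6 ?_ (norm_nonneg _) hB0
    rw [Real.norm_eq_abs, add_comm]
    refine (abs_add_le _ _).trans (add_le_add ?_ ?_)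
    · rw [abs_mul (G x), abs_mul (2 * ζ x), abs_mul 2, abs_two, abs_of_nonneg (hζ0 x), mul_comm]
      have := hζ0 x
      gcongr
    · rw [abs_mul, abs_of_nonneg (sq_nonneg (ζ x))]
      exact mul_le_mul_of_nonneg_left h3 (sq_nonneg _)
  have hf'u : Integrable fun x =>
      fderiv ℝ (fun y => ζ y ^ 2 * G y) x (EuclideanSpace.single a.1 1) * u x a.2 :=
    (((hf1.continuous_fderiv one_ne_zero).clm_apply continuous_const).mul
      huα.continuous).integrable_of_hasCompactSupport
      ((hsq.mul_right.fderiv_apply ℝ _).mul_right)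
  have hfu' : Integrable fun x => ζ x ^ 2 * G x *
      fderiv ℝ (fun y => u y a.2) x (EuclideanSpace.single a.1 1) :=
    (hf1.continuous.mul ((huα.continuous_fderiv two_ne_zero).clm_apply
      continuous_const)).integrable_of_hasCompactSupport hsq.mul_right.mul_right
  have hfu : Integrable fun x => ζ x ^ 2 * G x * u x a.2 :=
    (hf1.continuous.mul huα.continuous).integrable_of_hasCompactSupport hsq.mul_right.mul_right
  have heq : (fun x => ζ x ^ 2 * (H x ^ (p / 2) * grad u x a ^ 2)) = fun x => ζ x ^ 2 * G x *
      fderiv ℝ (fun y => u y a.2) x (EuclideanSpace.single a.1 1) := by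
    funext x
    rw [hdu]
    simp only [hG, hH]
    ring
  simp only [hH] at heq
  rw [heq]
  refine ⟨hfu', ?_⟩
  rw [integral_mul_fderiv_eq_neg_fderiv_mul_of_integrable hf'u hfu' hfu
    (fun x _ => hf1.differentiable one_ne_zero x)
    (fun x _ => huα.differentiable two_ne_zero x)]
  refine (neg_le_abs _).trans ?_
  exact norm_integral_le_of_norm_le hEint (Filter.Eventually.of_forall hdf)

lemma integral_le_of_interpolation {X : Type*} [MeasurableSpace X] {μ : Measure X}
    {f g y z e : X → ℝ} {a b c : ℝ} (hf : Integrable f μ) (hg : Integrable g μ)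
    (hy : Integrable y μ) (hz : Integrable z μ) (he : Integrable e μ)
    (hpt : ∀ x, f x + a * e x ≤ g x + (1 / 2 * f x + b * z x + c * y x))
    (hge : ∫ x, g x ∂μ ≤ a * ∫ x, e x ∂μ) :
    ∫ x, f x ∂μ ≤ 2 * b * (∫ x, z x ∂μ) + 2 * c * ∫ x, y x ∂μ := by
  have h1 : Integrable (fun x => 1 / 2 * f x + b * z x) μ :=
    (hf.const_mul _).add (hz.const_mul _)
  have h2 : Integrable (fun x => 1 / 2 * f x + b * z x + c * y x) μ := h1.add (hy.const_mul _)
  have hle : ∫ x, (f x + a * e x) ∂μ ≤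
      ∫ x, (g x + (1 / 2 * f x + b * z x + c * y x)) ∂μ :=
    integral_mono (hf.add (he.const_mul a)) (hg.add h2) hpt
  rw [integral_add hf (he.const_mul _), integral_const_mul, integral_add hg h2,
    integral_add h1 (hy.const_mul _), integral_add (hf.const_mul _) (hz.const_mul _),
    integral_const_mul, integral_const_mul, integral_const_mul] at hle
  linarith

/-- A Gagliardo–Nirenberg type interpolation inequality for bounded functions. -/
lemma integral_rpow_grad_interpolation (hu : ContDiff ℝ 2 u) {B : ℝ} (hB : ∀ x, ‖u x‖ ≤ B)
    {p q κ : ℝ} (hp : 0 ≤ p) (hpq : p ≤ q) {ζ t : Pt n → ℝ} (hζ : ContDiff ℝ 1 ζ)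
    (hζc : HasCompactSupport ζ) (ht : Continuous t) (htc : HasCompactSupport t)
    (hζ0 : ∀ x, 0 ≤ ζ x) (hζt : ∀ x, ζ x ≤ t x) (hκ : ∀ x, ‖fderiv ℝ ζ x‖ ≤ κ * t x) :
    ∫ x, ζ x ^ 2 * (1 + ‖grad u x‖ ^ 2) ^ ((p + 2) / 2) ≤
      2 * (1 + (2 * κ * (n * N * B)) ^ 2) * (∫ x, t x ^ 2 * (1 + ‖grad u x‖ ^ 2) ^ (q / 2)) +
      2 * ((p + 1) * (n * N * B)) ^ 2 *
        ∫ x, ζ x ^ 2 * ((1 + ‖grad u x‖ ^ 2) ^ ((p - 2) / 2) * hessSq u x) := by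
  have hgr := contDiff_grad hu
  set H : Pt n → ℝ := fun x => 1 + ‖grad u x‖ ^ 2 with hH
  have hH1 : ∀ x, 1 ≤ H x := fun x => by simp only [hH]; linarith [sq_nonneg ‖grad u x‖]
  have hH0 : ∀ x, 0 < H x := fun x => one_pos.trans_le (hH1 x)
  have hHc : ∀ r : ℝ, Continuous fun x => H x ^ r := continuous_one_add_grad_rpow hu
  have hsq : HasCompactSupport fun x => ζ x ^ 2 :=
    hζc.comp_left (g := fun y : ℝ => y ^ 2) (by simp)
  have htsq : HasCompactSupport fun x => t x ^ 2 :=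
    htc.comp_left (g := fun y : ℝ => y ^ 2) (by simp)
  have hB0 : 0 ≤ B := (norm_nonneg _).trans (hB 0)
  set E : Pt n → ℝ := fun x =>
    B * (2 * ζ x * ‖fderiv ℝ ζ x‖ * (H x ^ (p / 2) * √(H x)) +
      ζ x ^ 2 * ((p + 1) * H x ^ (p / 2) * √(hessSq u x))) with hE
  have hEc : Continuous E := by
    have h1 := hζ.continuous
    have h2 := hζ.continuous_fderiv one_ne_zero
    have h3 := hHc (p / 2)
    have h4 := (continuous_hessSq hu).sqrt
    have h5 : Continuous H := continuous_const.add (hgr.continuous.norm.pow 2)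
    have h6 := h5.sqrt
    exact continuous_const.mul ((((continuous_const.mul h1).mul h2.norm).mul (h3.mul h6)).add
      ((h1.pow 2).mul ((continuous_const.mul h3).mul h4)))
  have hEs : HasCompactSupport E := by
    have h1 : HasCompactSupport fun x =>
        2 * ζ x * ‖fderiv ℝ ζ x‖ * (H x ^ (p / 2) * √(H x)) :=
      (hζc.mul_left (f := fun _ => (2 : ℝ))).mul_right.mul_right
    have h2 : HasCompactSupport fun x =>
        ζ x ^ 2 * ((p + 1) * H x ^ (p / 2) * √(hessSq u x)) := hsq.mul_right
    exact (h1.add h2).mul_left (f := fun _ => B)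
  have hEint : Integrable E := hEc.integrable_of_hasCompactSupport hEs
  have hgrad : ∫ x, ζ x ^ 2 * (H x ^ (p / 2) * ‖grad u x‖ ^ 2) ≤ (n * N : ℝ) * ∫ x, E x := by
    have h1 : (fun x => ζ x ^ 2 * (H x ^ (p / 2) * ‖grad u x‖ ^ 2)) =
        fun x => ∑ a, ζ x ^ 2 * (H x ^ (p / 2) * grad u x a ^ 2) := by
      funext x
      simp only [← Finset.mul_sum, EuclideanSpace.norm_sq_eq, Real.norm_eq_abs, sq_abs]
    have h2 := integral_rpow_mul_grad_sq_le hu hB hp hζ hζc hζ0 hEint (fun _ => rfl)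
    rw [h1, integral_finsetSum _ fun a _ => (h2 a).1]
    calc ∑ a, ∫ x, ζ x ^ 2 * (H x ^ (p / 2) * grad u x a ^ 2)
        ≤ ∑ _a : Fin n × Fin N, ∫ x, E x := Finset.sum_le_sum fun a _ => (h2 a).2
      _ = (n * N : ℝ) * ∫ x, E x := by simp
  have hXint : Integrable fun x => ζ x ^ 2 * H x ^ ((p + 2) / 2) :=
    ((hζ.continuous.pow 2).mul (hHc _)).integrable_of_hasCompactSupport hsq.mul_right
  have hYint : Integrable fun x => ζ x ^ 2 * (H x ^ ((p - 2) / 2) * hessSq u x) :=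
    ((hζ.continuous.pow 2).mul ((hHc _).mul
      (continuous_hessSq hu))).integrable_of_hasCompactSupport hsq.mul_right
  have hZint : Integrable fun x => t x ^ 2 * H x ^ (q / 2) :=
    ((ht.pow 2).mul (hHc _)).integrable_of_hasCompactSupport htsq.mul_right
  have hgint : Integrable fun x => ζ x ^ 2 * (H x ^ (p / 2) * ‖grad u x‖ ^ 2) :=
    ((hζ.continuous.pow 2).mul ((hHc _).mul
      (hgr.continuous.norm.pow 2))).integrable_of_hasCompactSupport hsq.mul_right
  have hpt : ∀ x, ζ x ^ 2 * H x ^ ((p + 2) / 2) + (n * N : ℝ) * E x ≤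
      ζ x ^ 2 * (H x ^ (p / 2) * ‖grad u x‖ ^ 2) +
        (1 / 2 * (ζ x ^ 2 * H x ^ ((p + 2) / 2)) +
          (1 + (2 * κ * (n * N * B)) ^ 2) * (t x ^ 2 * H x ^ (q / 2)) +
          ((p + 1) * (n * N * B)) ^ 2 *
            (ζ x ^ 2 * (H x ^ ((p - 2) / 2) * hessSq u x))) := by
    intro x
    have h := interpolation_pointwise hpq (by positivity : 0 ≤ n * N * B) (hH1 x)
      (hessSq_nonneg u x) (hζ0 x) (hζt x) (hκ x)
    rw [show H x - 1 = ‖grad u x‖ ^ 2 by simp [hH], mul_assoc (n * N : ℝ) B] at h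
    exact h
  exact integral_le_of_interpolation hXint hgint hYint hZint hEint hpt hgrad

end Interpolation

lemma mul_pow_mul_rpow_le_absorb {p q C : ℝ} (hq : 0 < q) (hgap : q < p + 2) (hC : 0 ≤ C)
    {l : ℕ} (hl : q / (p + 2 - q) ≤ l) {s H : ℝ} (hs : 0 ≤ s) (hs1 : s ≤ 1)
    (hH : 1 ≤ H) :
    C * ((s ^ l) ^ 2 * H ^ (q / 2)) ≤ 1 / 2 * ((s ^ (l + 1)) ^ 2 * H ^ ((p + 2) / 2)) +
      C * (2 * C) ^ (q / (p + 2 - q)) := by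
  have hH0 : 0 < H := one_pos.trans_le hH
  have hd : 0 < p + 2 - q := by linarith
  by_cases h : 2 * C ≤ s ^ 2 * H ^ ((p + 2 - q) / 2)
  · have h1 : H ^ ((p + 2) / 2) = H ^ (q / 2) * H ^ ((p + 2 - q) / 2) := by
      rw [← Real.rpow_add hH0]; congr 1; ring
    have h2 : (0 : ℝ) ≤ C * (2 * C) ^ (q / (p + 2 - q)) := by positivity
    have h3 := mul_le_mul_of_nonneg_left h (by positivity : 0 ≤ (s ^ l) ^ 2 * H ^ (q / 2))
    rw [h1, pow_succ s l, mul_pow]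
    linarith
  · have h1 : (s ^ 2 * H ^ ((p + 2 - q) / 2)) ^ (q / (p + 2 - q)) ≤
        (2 * C) ^ (q / (p + 2 - q)) :=
      Real.rpow_le_rpow (by positivity) (not_le.1 h).le (by positivity)
    rw [Real.mul_rpow (by positivity) (by positivity), ← Real.rpow_mul hH0.le,
      ← Real.rpow_natCast, ← Real.rpow_mul hs] at h1
    have h2 : (p + 2 - q) / 2 * (q / (p + 2 - q)) = q / 2 := by field_simp
    rw [h2] at h1
    have h3 : (s ^ l) ^ 2 ≤ s ^ (((2 : ℕ) : ℝ) * (q / (p + 2 - q))) := by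
      rw [← pow_mul, ← Real.rpow_natCast]
      refine Real.rpow_le_rpow_of_exponent_ge' hs hs1 (by positivity) ?_
      push_cast
      linarith
    have h4 : (s ^ l) ^ 2 * H ^ (q / 2) ≤ (2 * C) ^ (q / (p + 2 - q)) :=
      (mul_le_mul_of_nonneg_right h3 (by positivity)).trans h1
    have h5 := mul_le_mul_of_nonneg_left h4 hC
    have h6 : 0 ≤ 1 / 2 * ((s ^ (l + 1)) ^ 2 * H ^ ((p + 2) / 2)) := by positivity
    linarith

section Localization

variable {n N : ℕ} {u v : Pt n → EuclideanSpace ℝ (Fin N)}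

lemma ContDiffOn.contDiff_smul {E F : Type*} [NormedAddCommGroup E] [NormedSpace ℝ E]
    [NormedAddCommGroup F] [NormedSpace ℝ F] {k : WithTop ℕ∞} {f : E → F} {χ : E → ℝ}
    {Ω : Set E} (hf : ContDiffOn ℝ k f Ω) (hΩ : IsOpen Ω) (hχ : ContDiff ℝ k χ)
    (hχΩ : tsupport χ ⊆ Ω) : ContDiff ℝ k fun x => χ x • f x := by
  refine contDiff_iff_contDiffAt.2 fun x => ?_
  by_cases hx : x ∈ tsupport χ
  · exact hχ.contDiffAt.smul (hf.contDiffAt (hΩ.mem_nhds (hχΩ hx)))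
  · refine (contDiffAt_const (c := (0 : F))).congr_of_eventuallyEq ?_
    filter_upwards [notMem_tsupport_iff_eventuallyEq.1 hx] with y hy
    simp [hy]

lemma grad_congr {x : Pt n} (h : u =ᶠ[𝓝 x] v) : grad u x = grad v x := by
  simp only [grad, h.fderiv_eq]

lemma eventuallyEq_grad {x : Pt n} (h : u =ᶠ[𝓝 x] v) : grad u =ᶠ[𝓝 x] grad v :=
  h.eventuallyEq_nhds.mono fun _ hy => grad_congr hy

lemma hessSq_congr {x : Pt n} (h : u =ᶠ[𝓝 x] v) : hessSq u x = hessSq v x := by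
  have h1 (i : Fin n) (α : Fin N) :
      (fun y => fderiv ℝ u y (EuclideanSpace.single i 1) α) =ᶠ[𝓝 x]
        fun y => fderiv ℝ v y (EuclideanSpace.single i 1) α :=
    (h.fderiv (𝕜 := ℝ)).mono fun y hy => by simp only [hy]
  simp only [hessSq, (h1 _ _).fderiv_eq]

lemma gradVSq_congr {x : Pt n} (p : ℝ) (h : u =ᶠ[𝓝 x] v) : gradVSq p u x = gradVSq p v x := by
  have h1 : (fun y => Vmap p (grad u y)) =ᶠ[𝓝 x] fun y => Vmap p (grad v y) :=
    (eventuallyEq_grad h).mono fun y hy => by simp only [hy]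
  simp only [gradVSq, h1.fderiv_eq]

lemma gradVSq_nonneg (p : ℝ) (u : Pt n → EuclideanSpace ℝ (Fin N)) (x : Pt n) :
    0 ≤ gradVSq p u x :=
  Finset.sum_nonneg fun _ _ => sq_nonneg _

lemma gradVSq_le (hu : ContDiff ℝ 2 u) (p : ℝ) (x : Pt n) :
    gradVSq p u x ≤
      (1 + |(p - 2) / 2|) ^ 2 * ((1 + ‖grad u x‖ ^ 2) ^ ((p - 2) / 2) * hessSq u x) := by
  have hd := ((contDiff_grad hu).differentiable one_ne_zero x).hasFDerivAt
  have hH0 : 0 < 1 + ‖grad u x‖ ^ 2 := by positivity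
  have hV := ((hd.norm_sq.const_add 1).rpow_const (p := (p - 2) / 4) (Or.inl hH0.ne')).smul hd
  rw [hessSq_eq hu, Finset.mul_sum, Finset.mul_sum]
  refine Finset.sum_le_sum fun s _ => ?_
  have hV' : fderiv ℝ (fun y => Vmap p (grad u y)) x = _ := hV.fderiv
  rw [hV']
  simp only [add_apply, smul_apply, smul_eq_mul, ContinuousLinearMap.comp_apply,
    innerSL_apply_apply, nsmul_eq_mul, Nat.cast_ofNat, ContinuousLinearMap.smulRight_apply]
  set D := fderiv ℝ (grad u) x (EuclideanSpace.single s 1)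
  set H := 1 + ‖grad u x‖ ^ 2 with hH
  have h1 : |inner ℝ (grad u x) D| ≤ ‖grad u x‖ * ‖D‖ := abs_real_inner_le_norm _ _
  have h2 : ‖grad u x‖ * ‖grad u x‖ ≤ H := by rw [hH]; nlinarith
  have h3 : H ^ ((p - 2) / 4) = H ^ ((p - 2) / 4 - 1) * H := by
    rw [← Real.rpow_add_one hH0.ne']; congr 1; ring
  have h4 : H ^ ((p - 2) / 2) = (H ^ ((p - 2) / 4)) ^ 2 := by
    rw [← Real.rpow_natCast, ← Real.rpow_mul hH0.le]; congr 1; push_cast; ring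
  have hP : 0 ≤ H ^ ((p - 2) / 4 - 1) := by positivity
  rw [h4, ← mul_pow, ← mul_pow]
  refine pow_le_pow_left₀ (norm_nonneg _) ?_ 2
  refine (norm_add_le _ _).trans ?_
  rw [norm_smul, norm_smul, Real.norm_of_nonneg (by positivity : 0 ≤ H ^ ((p - 2) / 4)),
    norm_mul, norm_mul, norm_mul, Real.norm_of_nonneg hP]
  simp only [Real.norm_eq_abs, abs_two]
  have h5 : |(p - 2) / 4| * 2 = |(p - 2) / 2| := by
    rw [← abs_two, ← abs_mul, abs_two]; congr 1; ring
  calc H ^ ((p - 2) / 4) * ‖D‖ +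
        |(p - 2) / 4| * H ^ ((p - 2) / 4 - 1) * (2 * |inner ℝ (grad u x) D|) * ‖grad u x‖
      ≤ H ^ ((p - 2) / 4) * ‖D‖ +
        |(p - 2) / 4| * H ^ ((p - 2) / 4 - 1) * (2 * (‖grad u x‖ * ‖D‖)) * ‖grad u x‖ := by
        gcongr
    _ = H ^ ((p - 2) / 4) * ‖D‖ + |(p - 2) / 4| * 2 *
        (H ^ ((p - 2) / 4 - 1) * (‖grad u x‖ * ‖grad u x‖)) * ‖D‖ := by ring
    _ ≤ H ^ ((p - 2) / 4) * ‖D‖ + |(p - 2) / 4| * 2 *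
        (H ^ ((p - 2) / 4 - 1) * H) * ‖D‖ := by gcongr
    _ = (1 + |(p - 2) / 2|) * (H ^ ((p - 2) / 4) * ‖D‖) := by rw [← h3, h5]; ring

lemma norm_Vmap_rpow_le {p q : ℝ} (hp : 0 < p) (hpq : p ≤ q) (hgap : q ≤ p + 2) (ξ : Vec n N) :
    ‖Vmap p ξ‖ ^ (2 * q / p) ≤ (1 + ‖ξ‖ ^ 2) ^ ((p + 2) / 2) := by
  have hH1 : 1 ≤ 1 + ‖ξ‖ ^ 2 := by linarith [sq_nonneg ‖ξ‖]
  have hH0 := one_pos.trans_le hH1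
  have h1 : ‖Vmap p ξ‖ ≤ (1 + ‖ξ‖ ^ 2) ^ (p / 4) := by
    rw [Vmap, norm_smul, Real.norm_of_nonneg (by positivity)]
    calc _ ≤ (1 + ‖ξ‖ ^ 2) ^ ((p - 2) / 4) * √(1 + ‖ξ‖ ^ 2) := by
          gcongr; exact norm_le_sqrt_one_add_sq ξ
      _ = _ := by
          rw [Real.sqrt_eq_rpow, ← Real.rpow_add hH0]; congr 1; ring
  calc _ ≤ ((1 + ‖ξ‖ ^ 2) ^ (p / 4)) ^ (2 * q / p) :=
        Real.rpow_le_rpow (norm_nonneg _) h1 (div_nonneg (by linarith) hp.le)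
    _ = (1 + ‖ξ‖ ^ 2) ^ (q / 2) := by
        rw [← Real.rpow_mul hH0.le]; congr 1; field_simp; ring
    _ ≤ _ := Real.rpow_le_rpow_of_exponent_le hH1 (by linarith)

/-- Testing a weak solution with a single component. -/
lemma IsWeakSolution.integral_component_eq_zero {A : Vec n N → Vec n N} {Ω U : Set (Pt n)}
    (hw : IsWeakSolution A Ω u) (hUΩ : U ⊆ Ω) (huv : ∀ x ∈ U, u =ᶠ[𝓝 x] v) (α : Fin N)
    {g : Pt n → ℝ} (hg : ContDiff ℝ ∞ g) (hgc : HasCompactSupport g) (hgU : tsupport g ⊆ U) :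
    ∫ x, ∑ i, A (grad v x) (i, α) * fderiv ℝ g x (EuclideanSpace.single i 1) = 0 := by
  have h := hw (fun x => g x • EuclideanSpace.single α 1) (hg.smul contDiff_const)
    hgc.smul_right ((closure_mono (Function.support_smul_subset_left _ _)).trans
      (hgU.trans hUΩ))
  have hz : ∀ x, x ∉ tsupport g → fderiv ℝ g x = 0 := fun x hx =>
    image_eq_zero_of_notMem_tsupport fun h' => hx (tsupport_fderiv_subset ℝ h')
  have heq : ∀ x, ∑ i : Fin n, ∑ β : Fin N, A (grad u x) (i, β) *
      fderiv ℝ (fun y => g y • EuclideanSpace.single α (1 : ℝ)) x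
        (EuclideanSpace.single i 1) β =
      ∑ i, A (grad v x) (i, α) * fderiv ℝ g x (EuclideanSpace.single i 1) := by
    intro x
    rw [((hg.differentiable (by simp) x).hasFDerivAt.smul_const
      (EuclideanSpace.single α (1 : ℝ))).fderiv]
    by_cases hx : x ∈ tsupport g
    · simp [grad_congr (huv x (hgU hx)), PiLp.single_apply]
    · simp [hz x hx]
  simp only [heq] at h
  rwa [setIntegral_eq_integral_of_forall_compl_eq_zero] at h
  intro x hx
  simp [hz x fun h' => hx (hUΩ (hgU h'))]

end Localization

/-- The local a priori estimate for globally defined functions that solve the system near the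
support of the cutoff `η`. -/
lemma exists_apriori_bound (n N : ℕ) {p q m M B : ℝ} (hp : 0 ≤ p) (hpq : p ≤ q) (hq : 0 < q)
    (hm : 0 < m) (hM : 0 < M) (hgap : q < p + 2) {U : Set (Pt n)} (hU : IsOpen U)
    {η : Pt n → ℝ} (hη : ContDiff ℝ ∞ η) (hηc : HasCompactSupport η) (hηU : tsupport η ⊆ U)
    (hη01 : ∀ x, η x ∈ Set.Icc (0 : ℝ) 1) :
    ∃ k : ℕ, k ≠ 0 ∧ ∃ K : ℝ, ∀ A : Vec n N → Vec n N, EllipticGrowth n N p q m M A →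
      SkewControl n N p q M A → ∀ u : Pt n → EuclideanSpace ℝ (Fin N), ContDiff ℝ 2 u →
      (∀ x, ‖u x‖ ≤ B) →
      (∀ α, ∀ g : Pt n → ℝ, ContDiff ℝ ∞ g → HasCompactSupport g → tsupport g ⊆ U →
        ∫ x, ∑ i, A (grad u x) (i, α) * fderiv ℝ g x (EuclideanSpace.single i 1) = 0) →
      ∫ x, (η x ^ k) ^ 2 * (1 + ‖grad u x‖ ^ 2) ^ ((p + 2) / 2) ≤ K ∧
      ∫ x, (η x ^ k) ^ 2 * ((1 + ‖grad u x‖ ^ 2) ^ ((p - 2) / 2) * hessSq u x) ≤ K := by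
  obtain ⟨l, hl⟩ := exists_nat_ge (q / (p + 2 - q))
  have hl0 : l ≠ 0 := by
    rintro rfl
    have : 0 < q / (p + 2 - q) := div_pos hq (by linarith)
    norm_num at hl
    linarith
  have hη1 : ContDiff ℝ 1 η := hη.of_le (by exact_mod_cast le_top)
  obtain ⟨Λ, hΛ⟩ := (hη1.continuous_fderiv one_ne_zero).bounded_above_of_compact_support
    (hηc.fderiv ℝ)
  have hpowc : ∀ j : ℕ, j ≠ 0 → HasCompactSupport fun x => η x ^ j := fun j hj =>
    hηc.comp_left (g := fun y : ℝ => y ^ j) (zero_pow hj)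
  have hpows : ∀ j : ℕ, j ≠ 0 → tsupport (fun x => η x ^ j) ⊆ tsupport η := fun j hj =>
    closure_mono fun x hx hx0 => hx (by simp [hx0, hj])
  set κ : ℝ := (l + 1) * Λ with hκ
  have hdζ : ∀ x, ‖fderiv ℝ (fun y => η y ^ (l + 1)) x‖ ≤ κ * η x ^ l := by
    intro x
    have h1 := ((hη1.differentiable one_ne_zero x).hasFDerivAt.pow (l + 1)).fderiv
    have h2 : 0 ≤ η x ^ l := pow_nonneg (hη01 x).1 l
    have h3 : fderiv ℝ (fun y => η y ^ (l + 1)) x =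
        (((l + 1 : ℕ) : ℝ) * η x ^ l) • fderiv ℝ η x := by simpa using h1
    rw [h3, norm_smul, Real.norm_of_nonneg (by positivity), hκ, mul_right_comm]
    push_cast
    gcongr
    exact hΛ x
  set c : ℝ := (2 * (M * (n * N : ℝ) ^ 2) + (M * (n * N : ℝ) ^ 2) ^ 2 / m) * n with hc
  have hc0 : 0 ≤ c := by positivity
  set D : ℝ := 4 / m * (c * κ ^ 2) with hD
  have hD0 : 0 ≤ D := by positivity
  set a : ℝ := 2 * (1 + (2 * κ * (n * N * B)) ^ 2) with ha
  set b : ℝ := 2 * ((p + 1) * (n * N * B)) ^ 2 with hb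
  have hb0 : 0 ≤ b := by positivity
  have ha1 : 1 ≤ a := by rw [ha]; nlinarith [sq_nonneg (2 * κ * (n * N * B))]
  have hab1 : 1 ≤ a + b * D := le_add_of_le_of_nonneg ha1 (by positivity)
  set T : ℝ := (a + b * D) * (2 * (a + b * D)) ^ (q / (p + 2 - q)) *
    volume.real (tsupport η) with hT
  refine ⟨l + 1, l.succ_ne_zero, max (2 * T) (D * (2 * T)), fun A hA hS u hu hB hw => ?_⟩
  have hX0 : 0 ≤ ∫ x, (η x ^ (l + 1)) ^ 2 * (1 + ‖grad u x‖ ^ 2) ^ ((p + 2) / 2) :=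
    integral_nonneg fun x => by positivity
  have hZ0 : 0 ≤ ∫ x, (η x ^ l) ^ 2 * (1 + ‖grad u x‖ ^ 2) ^ (q / 2) :=
    integral_nonneg fun x => by positivity
  have hXint : Integrable fun x =>
      (η x ^ (l + 1)) ^ 2 * (1 + ‖grad u x‖ ^ 2) ^ ((p + 2) / 2) := by
    have h : HasCompactSupport fun x => (η x ^ (l + 1)) ^ 2 := by
      simpa only [← pow_mul] using hpowc ((l + 1) * 2) (by positivity)
    exact (((hη1.continuous.pow _).pow 2).mul
      (continuous_one_add_grad_rpow hu _)).integrable_of_hasCompactSupport h.mul_right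
  have hZint : Integrable fun x => (η x ^ l) ^ 2 * (1 + ‖grad u x‖ ^ 2) ^ (q / 2) := by
    have h : HasCompactSupport fun x => (η x ^ l) ^ 2 := by
      simpa only [← pow_mul] using hpowc (l * 2) (by positivity)
    exact (((hη1.continuous.pow _).pow 2).mul
      (continuous_one_add_grad_rpow hu _)).integrable_of_hasCompactSupport h.mul_right
  have hcacc := hA.caccioppoli hm hM hS hu hU hw (hη.pow (l + 1)) (hpowc _ l.succ_ne_zero)
    ((hpows _ l.succ_ne_zero).trans hηU)
  have hinterp := integral_rpow_grad_interpolation hu hB hp hpq (hη1.pow (l + 1))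
    (hpowc _ l.succ_ne_zero) (hη1.continuous.pow l) (hpowc l hl0)
    (fun x => pow_nonneg (hη01 x).1 _)
    (fun x => pow_le_pow_of_le_one (hη01 x).1 (hη01 x).2 l.le_succ) hdζ
  have hdζint : ∫ x, ‖fderiv ℝ (fun y => η y ^ (l + 1)) x‖ ^ 2 *
      (1 + ‖grad u x‖ ^ 2) ^ (q / 2) ≤
      κ ^ 2 * ∫ x, (η x ^ l) ^ 2 * (1 + ‖grad u x‖ ^ 2) ^ (q / 2) := by
    rw [← integral_const_mul]
    refine integral_mono_of_nonneg (Filter.Eventually.of_forall fun x => by positivity)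
      (hZint.const_mul _) (Filter.Eventually.of_forall fun x => ?_)
    have h := pow_le_pow_left₀ (norm_nonneg _) (hdζ x) 2
    rw [mul_pow] at h
    simp only [← mul_assoc]
    gcongr
  have habs : (a + b * D) * ∫ x, (η x ^ l) ^ 2 * (1 + ‖grad u x‖ ^ 2) ^ (q / 2) ≤
      1 / 2 * (∫ x, (η x ^ (l + 1)) ^ 2 * (1 + ‖grad u x‖ ^ 2) ^ ((p + 2) / 2)) + T := by
    have hind : Integrable ((tsupport η).indicator fun _ : Pt n =>
        (a + b * D) * (2 * (a + b * D)) ^ (q / (p + 2 - q))) :=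
      (integrable_indicator_iff (isClosed_tsupport η).measurableSet).2
        (integrableOn_const hηc.measure_lt_top.ne)
    have h1 := integral_mono (hZint.const_mul (a + b * D))
      ((hXint.const_mul (1 / 2)).add hind) (fun x => ?_)
    · rw [integral_const_mul, integral_add' (hXint.const_mul _) hind, integral_const_mul,
        integral_indicator_const _ (isClosed_tsupport η).measurableSet, smul_eq_mul,
        mul_comm (volume.real _)] at h1
      exact h1
    · by_cases hx : x ∈ tsupport η
      · simp only [Pi.add_apply, Set.indicator_of_mem hx]
        exact mul_pow_mul_rpow_le_absorb hq hgap (by linarith) hl (hη01 x).1 (hη01 x).2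
          (le_add_of_nonneg_right (sq_nonneg _))
      · simp [Set.indicator_of_notMem hx, image_eq_zero_of_notMem_tsupport hx, hl0]
  set X := ∫ x, (η x ^ (l + 1)) ^ 2 * (1 + ‖grad u x‖ ^ 2) ^ ((p + 2) / 2)
  set Y := ∫ x, (η x ^ (l + 1)) ^ 2 * ((1 + ‖grad u x‖ ^ 2) ^ ((p - 2) / 2) * hessSq u x)
  set Z := ∫ x, (η x ^ l) ^ 2 * (1 + ‖grad u x‖ ^ 2) ^ (q / 2)
  have hYZ : Y ≤ D * Z := by
    have h1 : m / 4 * Y ≤ c * (κ ^ 2 * Z) := hcacc.trans (mul_le_mul_of_nonneg_left hdζint hc0)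
    calc Y = 4 / m * (m / 4 * Y) := by field_simp
      _ ≤ 4 / m * (c * (κ ^ 2 * Z)) := by gcongr
      _ = D * Z := by rw [hD]; ring
  have hXZ : X ≤ (a + b * D) * Z := by
    calc X ≤ a * Z + b * Y := hinterp
      _ ≤ a * Z + b * (D * Z) := by gcongr
      _ = (a + b * D) * Z := by ring
  have hX : X ≤ 2 * T := by linarith
  have hZ : Z ≤ 2 * T := (le_mul_of_one_le_left hZ0 hab1).trans (by linarith)
  exact ⟨hX.trans (le_max_left _ _),
    (hYZ.trans (mul_le_mul_of_nonneg_left hZ hD0)).trans (le_max_right _ _)⟩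

/-- Theorem 1.2 ii): local higher differentiability for bounded solutions under
q < p + 2 and p < n. -/
theorem statement3 {n N : ℕ} (hn : 2 ≤ n) (hN : 1 ≤ N) {p q m M : ℝ}
    (hp : 1 < p) (hpq : p ≤ q) (hm : 0 < m) (hM : 0 < M)
    (hgap : q < p + 2) (hpn : p < (n : ℝ))
    (Ω : Set (Pt n)) (hΩ : IsOpen Ω) (hΩb : Bornology.IsBounded Ω)
    (Ω' : Set (Pt n)) (hΩ' : IsOpen Ω') (hΩ'c : IsCompact (closure Ω'))
    (hΩ'Ω : closure Ω' ⊆ Ω) (L B : ℝ) (hL : 0 < L) (hB : 0 < B) :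
    ∃ C > 0, ∀ (A : Vec n N → Vec n N), EllipticGrowth n N p q m M A →
      SkewControl n N p q M A →
      ∀ (u : Pt n → EuclideanSpace ℝ (Fin N)), ContDiffOn ℝ 2 u Ω →
        IsWeakSolution A Ω u →
        (∫ x in Ω, ‖grad u x‖ ^ p) ≤ L →
        (∀ x ∈ Ω, ‖u x‖ ≤ B) →
        ∫ x in Ω', (‖Vmap p (grad u x)‖ ^ (2 * q / p) + gradVSq p u x +
            (1 + ‖grad u x‖ ^ 2) ^ ((p - 2) / 2) * hessSq u x) ≤ C := by
  obtain ⟨η, hη, hηc, hηΩ, hη1, hη01⟩ := exists_smooth_cutoff hΩ'c hΩ hΩ'Ω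
  obtain ⟨χ, hχ, -, hχΩ, hχ1, hχ01⟩ :=
    exists_smooth_cutoff (hηc : IsCompact (tsupport η)) hΩ hηΩ
  obtain ⟨U, hU, hηU, hχU⟩ := mem_nhdsSet_iff_exists.1 hχ1
  have hη1' : ∀ x ∈ Ω', η x = 1 := fun x hx =>
    (hη1.filter_mono (nhds_le_nhdsSet (subset_closure hx))).self_of_nhds
  have hΩ'U : Ω' ⊆ U := fun x hx => hηU (subset_tsupport η (by simp [hη1' x hx]))
  obtain ⟨k, hk, K, hK⟩ := exists_apriori_bound n N (B := B) (zero_le_one.trans hp.le) hpq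
    (by linarith) hm hM hgap (hU.inter hΩ) hη hηc (Set.subset_inter hηU hηΩ) hη01
  set c : ℝ := (1 + |(p - 2) / 2|) ^ 2 + 1 with hc
  refine ⟨|K + c * K| + 1, by positivity, fun A hA hS u hu hw _ huB => ?_⟩
  set v : Pt n → EuclideanSpace ℝ (Fin N) := fun x => χ x • u x with hv
  have hv2 : ContDiff ℝ 2 v :=
    hu.contDiff_smul hΩ (contDiff_infty.1 hχ 2) hχΩ
  have huv : ∀ x ∈ U, u =ᶠ[𝓝 x] v := fun x hx => by
    filter_upwards [hU.mem_nhds hx] with y hy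
    have hy1 : χ y = 1 := hχU hy
    simp [hv, hy1]
  have hvB : ∀ x, ‖v x‖ ≤ B := fun x => by
    rw [hv, norm_smul, Real.norm_of_nonneg (hχ01 x).1]
    by_cases hx : x ∈ Ω
    · exact (mul_le_of_le_one_left (norm_nonneg _) (hχ01 x).2).trans (huB x hx)
    · simpa [image_eq_zero_of_notMem_tsupport fun h => hx (hχΩ h)] using hB.le
  obtain ⟨hX, hY⟩ := hK A hA hS v hv2 hvB fun α g hg hgc hgU =>
    hw.integral_component_eq_zero Set.inter_subset_right (fun x hx => huv x hx.1) α hg hgc hgU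
  have hcs : HasCompactSupport fun x => (η x ^ k) ^ 2 :=
    hηc.comp_left (g := fun y : ℝ => (y ^ k) ^ 2) (by simp [hk])
  have hηk : Continuous fun x => (η x ^ k) ^ 2 := (hη.continuous.pow k).pow 2
  have hXint : Integrable fun x => (η x ^ k) ^ 2 * (1 + ‖grad v x‖ ^ 2) ^ ((p + 2) / 2) :=
    (hηk.mul (continuous_one_add_grad_rpow hv2 _)).integrable_of_hasCompactSupport hcs.mul_right
  have hYint : Integrable fun x =>
      (η x ^ k) ^ 2 * ((1 + ‖grad v x‖ ^ 2) ^ ((p - 2) / 2) * hessSq v x) :=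
    (hηk.mul ((continuous_one_add_grad_rpow hv2 _).mul
      (continuous_hessSq hv2))).integrable_of_hasCompactSupport hcs.mul_right
  have hint := hXint.add (hYint.const_mul c)
  have hc0 : 0 ≤ c := by positivity
  calc _ ≤ ∫ x in Ω', ((η x ^ k) ^ 2 * (1 + ‖grad v x‖ ^ 2) ^ ((p + 2) / 2) +
        c * ((η x ^ k) ^ 2 * ((1 + ‖grad v x‖ ^ 2) ^ ((p - 2) / 2) * hessSq v x))) := by
        refine integral_mono_of_nonneg (Filter.Eventually.of_forall fun x => ?_)
          hint.integrableOn ((ae_restrict_iff' hΩ'.measurableSet).2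
            (Filter.Eventually.of_forall fun x hx => ?_))
        · have h1 := gradVSq_nonneg p u x
          have h2 := hessSq_nonneg u x
          simp only [Pi.zero_apply]
          positivity
        · have he := huv x (hΩ'U hx)
          have h1 := norm_Vmap_rpow_le (by linarith) hpq hgap.le (grad v x)
          have h2 := gradVSq_le hv2 p x
          simp only [grad_congr he, gradVSq_congr p he, hessSq_congr he, hη1' x hx, one_pow,
            one_mul]
          rw [hc]
          linarith
    _ ≤ ∫ x, ((η x ^ k) ^ 2 * (1 + ‖grad v x‖ ^ 2) ^ ((p + 2) / 2) +
        c * ((η x ^ k) ^ 2 * ((1 + ‖grad v x‖ ^ 2) ^ ((p - 2) / 2) * hessSq v x))) := by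
        refine setIntegral_le_integral hint (Filter.Eventually.of_forall fun x => ?_)
        have h2 := hessSq_nonneg v x
        simp only [Pi.zero_apply]
        positivity
    _ ≤ K + c * K := by
        rw [integral_add hXint (hYint.const_mul c), integral_const_mul]
        exact add_le_add hX (mul_le_mul_of_nonneg_left hY hc0)
    _ ≤ |K + c * K| + 1 := (le_abs_self _).trans (by linarith)
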